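/- arXiv:1502.04829 — 3 statements merged into one kernel-verified Lean document; each statement's English description precedes it below -/
import Mathlib

section
/- Let T be a finite monoid, S a submonoid of T, and y ∈ T with y² = 1, such that T is generated by S ∪ {y}. Let X = {x_1,…,x_k} be a generating set of S with associated surjection φ : X* → S, and suppose S is defined by the presentation ⟨X | R⟩ (i.e. the induced map X*/ρ_R → S is an isomorphism). Let W ⊆ X* be a set of forms for ⟨X | R⟩ containing the empty word (i.e. every word of X* is ρ_R-congruent to a word of W), and suppose W = W_α ∪ W_β where some fixed word u₀ ∈ X* is a factor of every word in W_α. Suppose there exist words v₀, v₁, …, v_k ∈ X* such that in T the relations y·φ(x_i) = φ(v_i)·y hold for all 1 ≤ i ≤ k, and φ(u₀)·y = φ(v₀). Set Y = X ∪ {y}, R̄ = R ∪ {y² = 1} ∪ {y x_i = v_i y : 1 ≤ i ≤ k} ∪ {u₀ y = v₀} (relations over Y*), and W̄ = W ∪ {w y : w ∈ W_β}. Then W̄ is a set of forms for ⟨Y | R̄⟩, and moreover if |W̄| ≤ |T| then T is defined by the presentation ⟨Y | R̄⟩. -/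
namespace PIso

universe u v

/-- The letter `y` of the enlarged alphabet `Y = X ∪ {y}` (realized as `Option X`,
with `y` the extra letter `none`). -/
def yltr (X : Type*) : FreeMonoid (Option X) := FreeMonoid.of none

/-- The canonical embedding `X* → Y*`. -/
def embY {X : Type*} : FreeMonoid X →* FreeMonoid (Option X) :=
  FreeMonoid.map some

/-- The homomorphism `Y* → T` extending `ψ : X* → T` and sending the letter `y` to `y`. -/
def liftY {X : Type*} {T : Type*} [Monoid T] (ψ : FreeMonoid X →* T) (y : T) :
    FreeMonoid (Option X) →* T :=
  FreeMonoid.lift fun o => o.elim y fun i => ψ (FreeMonoid.of i)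

/-- The relation set `R̄ = R ∪ NR₀ ∪ NR₁ ∪ NR₂` over the alphabet `Y = X ∪ {y}`. -/
def RbarY {X : Type*} (r : FreeMonoid X → FreeMonoid X → Prop)
    (v : X → FreeMonoid X) (u₀ v₀ : FreeMonoid X)
    (a b : FreeMonoid (Option X)) : Prop :=
  (∃ u u' : FreeMonoid X, r u u' ∧ a = embY u ∧ b = embY u') ∨
  (a = yltr X * yltr X ∧ b = 1) ∨
  (∃ i : X, a = yltr X * embY (FreeMonoid.of i) ∧ b = embY (v i) * yltr X) ∨
  (a = embY u₀ * yltr X ∧ b = embY v₀)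

section Monoid

variable {X M : Type*} [Monoid M] {v : X → FreeMonoid X} {e : FreeMonoid X →* M} {y : M}

theorem mul_map_eq_map_lift_mul (h : ∀ i, y * e (FreeMonoid.of i) = e (v i) * y)
    (w : FreeMonoid X) : y * e w = e (FreeMonoid.lift v w) * y := by
  induction w using FreeMonoid.inductionOn' with
  | one => simp
  | of_mul i w ih =>
    rw [map_mul, ← mul_assoc, h, mul_assoc, ih, map_mul, map_mul, FreeMonoid.lift_eval_of,
      mul_assoc]

theorem map_mul_eq_mul_map_lift (hy : y * y = 1)
    (h : ∀ i, y * e (FreeMonoid.of i) = e (v i) * y) (w : FreeMonoid X) :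
    e w * y = y * e (FreeMonoid.lift v w) := by
  calc e w * y = y * (y * e w) * y := by rw [← mul_assoc y y, hy, one_mul]
    _ = y * e (FreeMonoid.lift v w) := by
      rw [mul_map_eq_map_lift_mul h, mul_assoc, mul_assoc, hy, mul_one]

/-- Modulo the relations `y² = 1` and `y x_i = v_i y`, every word over `Y` is represented by
a word over `X`, possibly followed by `y`. -/
theorem exists_eq_map_or_eq_map_mul (f : FreeMonoid (Option X) →* M)
    (hy : f (yltr X) * f (yltr X) = 1)
    (h : ∀ i, f (yltr X) * f (embY (FreeMonoid.of i)) = f (embY (v i)) * f (yltr X))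
    (w : FreeMonoid (Option X)) :
    ∃ a : FreeMonoid X, f w = f (embY a) ∨ f w = f (embY a) * f (yltr X) := by
  have hcomm := mul_map_eq_map_lift_mul (e := f.comp embY) h
  simp only [MonoidHom.comp_apply] at hcomm
  induction w using FreeMonoid.inductionOn' with
  | one => exact ⟨1, Or.inl (by simp)⟩
  | of_mul o w ih =>
    obtain ⟨a, ha⟩ := ih
    cases o with
    | some i =>
      have hi : FreeMonoid.of (some i) = embY (FreeMonoid.of i) := rfl
      refine ⟨FreeMonoid.of i * a, ha.imp (fun ha => ?_) fun ha => ?_⟩ <;>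
        simp only [map_mul, ha, hi, mul_assoc]
    | none =>
      have hn : FreeMonoid.of none = yltr X := rfl
      refine ⟨FreeMonoid.lift v a, ha.symm.imp (fun ha => ?_) fun ha => ?_⟩
      · rw [map_mul, ha, hn, ← mul_assoc, hcomm, mul_assoc, hy, mul_one]
      · rw [map_mul, ha, hn, hcomm]

end Monoid

section LiftY

variable {X T : Type*} [Monoid T] (ψ : FreeMonoid X →* T) (y : T)

theorem liftY_yltr : liftY ψ y (yltr X) = y := rfl

theorem liftY_embY (w : FreeMonoid X) : liftY ψ y (embY w) = ψ w := by
  have : (liftY ψ y).comp embY = ψ := FreeMonoid.hom_eq fun _ => rfl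
  exact DFunLike.congr_fun this w

theorem liftY_surjective (h : Submonoid.closure ((MonoidHom.mrange ψ : Set T) ∪ {y}) = ⊤) :
    Function.Surjective (liftY ψ y) := by
  rw [← MonoidHom.mrange_eq_top, eq_top_iff, ← h, Submonoid.closure_le]
  rintro t (⟨w, rfl⟩ | rfl)
  · exact ⟨embY w, liftY_embY ψ y w⟩
  · exact ⟨yltr X, rfl⟩

end LiftY

/-- A map with finite codomain that is surjective on a set no larger than the codomain is
injective on that set. -/
theorem injOn_of_surjOn_of_lift_mk_le {A : Type u} {T : Type v} [Finite T] {s : Set A}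
    {f : A → T} (hf : Set.SurjOn f s Set.univ)
    (hc : Cardinal.lift.{v} (Cardinal.mk s) ≤ Cardinal.lift.{u} (Cardinal.mk T)) :
    Set.InjOn f s := by
  obtain ⟨g⟩ := Cardinal.lift_mk_le'.1 hc
  have : Finite s := Finite.of_injective g g.injective
  have hs : Function.Surjective (s.domRestrict f) := fun t =>
    let ⟨a, ha, hat⟩ := hf (Set.mem_univ t)
    ⟨⟨a, ha⟩, hat⟩
  rw [Set.injOn_iff_injective]
  exact (hs.bijective_of_nat_card_le (Nat.card_le_card_of_injective g g.injective)).1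

/-- Theorem 2.4 of Fernandes–Gomes–Jesus: given a presentation
`⟨X | R⟩` of a submonoid `S` of a finite monoid `T`, an involution `y` generating `T`
together with `S`, a set of forms `W = W_α ∪ W_β` containing the empty word such that
`u₀` is a factor of every word of `W_α`, and relations `y x_i = v_i y` and `u₀ y = v₀`
holding in `T`, the set `W̄ = W ∪ W_β y` is a set of forms for `⟨Y | R̄⟩`; moreover if
`|W̄| ≤ |T|` then `T` is defined by the presentation `⟨Y | R̄⟩`. -/
theorem extend_presentation {X : Type u} {T : Type v} [Monoid T] [Finite T]
    (S : Submonoid T) (y : T) (hy : y * y = 1)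
    (hgen : Submonoid.closure ((S : Set T) ∪ {y}) = ⊤)
    (ψ : FreeMonoid X →* T)
    (hrange : MonoidHom.mrange ψ = S)
    (r : FreeMonoid X → FreeMonoid X → Prop)
    (hker : Con.ker ψ = conGen r)
    (W Wa Wb : Set (FreeMonoid X))
    (hforms : ∀ w : FreeMonoid X, ∃ w' ∈ W, conGen r w w')
    (hone : (1 : FreeMonoid X) ∈ W)
    (hWab : W = Wa ∪ Wb)
    (u₀ : FreeMonoid X) (hu₀ : ∀ w ∈ Wa, ∃ p q : FreeMonoid X, w = p * u₀ * q)
    (v : X → FreeMonoid X) (v₀ : FreeMonoid X)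
    (hNR1 : ∀ i : X, y * ψ (FreeMonoid.of i) = ψ (v i) * y)
    (hNR2 : ψ u₀ * y = ψ v₀) :
    (∀ w : FreeMonoid (Option X),
        ∃ w' ∈ embY '' W ∪ (fun u => embY u * yltr X) '' Wb,
          conGen (RbarY r v u₀ v₀) w w') ∧
    (Cardinal.lift.{v} (Cardinal.mk ↥(embY '' W ∪ (fun u => embY u * yltr X) '' Wb)) ≤
        Cardinal.lift.{u} (Cardinal.mk T) →
      Con.ker (liftY ψ y) = conGen (RbarY r v u₀ v₀) ∧
        Function.Surjective (liftY ψ y)) := by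
  subst hrange
  set C := conGen (RbarY r v u₀ v₀)
  have hrel {a b} (h : RbarY r v u₀ v₀ a b) : C.mk' a = C.mk' b :=
    (Con.eq C).2 (ConGen.Rel.of _ _ h)
  have hqy : C.mk' (yltr X) * C.mk' (yltr X) = 1 := by
    simpa only [map_mul, map_one] using hrel (Or.inr (Or.inl ⟨rfl, rfl⟩))
  have hqv (i : X) : C.mk' (yltr X) * C.mk' (embY (FreeMonoid.of i)) =
      C.mk' (embY (v i)) * C.mk' (yltr X) := by
    simpa only [map_mul] using hrel (Or.inr (Or.inr (Or.inl ⟨i, rfl, rfl⟩)))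
  have hqu : C.mk' (embY u₀) * C.mk' (yltr X) = C.mk' (embY v₀) := by
    simpa only [map_mul] using hrel (Or.inr (Or.inr (Or.inr ⟨rfl, rfl⟩)))
  have hqr {a b : FreeMonoid X} (h : conGen r a b) : C.mk' (embY a) = C.mk' (embY b) := by
    have hle : conGen r ≤ Con.ker (C.mk'.comp embY) :=
      Con.conGen_le.2 fun a b hab => hrel (Or.inl ⟨a, b, hab, rfl, rfl⟩)
    exact hle h
  have hcomm := map_mul_eq_mul_map_lift (e := C.mk'.comp embY) hqy hqv
  simp only [MonoidHom.comp_apply] at hcomm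
  have hW : ∀ w : FreeMonoid (Option X),
      ∃ w' ∈ embY '' W ∪ (fun u => embY u * yltr X) '' Wb, C w w' := by
    intro w
    simp only [← Con.eq]
    obtain ⟨a, ha | ha⟩ := exists_eq_map_or_eq_map_mul C.mk' hqy hqv w
    · obtain ⟨b, hb, hab⟩ := hforms a
      exact ⟨embY b, Or.inl ⟨b, hb, rfl⟩, ha.trans (hqr hab)⟩
    · obtain ⟨b, hb, hab⟩ := hforms a
      rw [hqr hab] at ha
      rcases hWab ▸ hb with hb | hb
      · obtain ⟨p, q, rfl⟩ := hu₀ b hb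
        obtain ⟨c, hc, hpc⟩ := hforms (p * v₀ * FreeMonoid.lift v q)
        refine ⟨embY c, Or.inl ⟨c, hc, rfl⟩, ha.trans (Eq.trans ?_ (hqr hpc))⟩
        simp only [map_mul, mul_assoc, hcomm q, ← hqu]
      · exact ⟨embY b * yltr X, Or.inr ⟨b, hb, rfl⟩, ha⟩
  refine ⟨hW, fun hcard => ?_⟩
  have hsurj := liftY_surjective ψ y hgen
  have hle : C ≤ Con.ker (liftY ψ y) := by
    refine Con.conGen_le.2 fun a b hab => ?_
    rw [Con.ker_rel]
    rcases hab with ⟨a, b, hab, rfl, rfl⟩ | ⟨rfl, rfl⟩ | ⟨i, rfl, rfl⟩ | ⟨rfl, rfl⟩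
    · rw [liftY_embY, liftY_embY, ← Con.ker_rel, hker]
      exact ConGen.Rel.of _ _ hab
    · rw [map_mul, liftY_yltr, hy, map_one]
    · simpa only [map_mul, liftY_yltr, liftY_embY] using hNR1 i
    · simpa only [map_mul, liftY_yltr, liftY_embY] using hNR2
  have hinj := injOn_of_surjOn_of_lift_mk_le (f := liftY ψ y) (fun t _ => by
    obtain ⟨w, rfl⟩ := hsurj t
    obtain ⟨w', hw', hww'⟩ := hW w
    exact ⟨w', hw', (hle hww').symm⟩) hcard
  refine ⟨le_antisymm (fun a b hab => ?_) hle, hsurj⟩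
  obtain ⟨a', ha', haa'⟩ := hW a
  obtain ⟨b', hb', hbb'⟩ := hW b
  have hab' : a' = b' :=
    hinj ha' hb' ((hle haa').symm.trans (Eq.trans hab (hle hbb')))
  subst hab'
  exact C.trans haa' (C.symm hbb')

end PIso
end

section
/- Let A = {x_1, …, x_n} be an alphabet and R the set of relations (R1)–(R12) listed in the context. Define the following subsets of A*: W_{n−1} = {x_1, …, x_n, x_{n−1}x_n, x_n x_{n−1}}; for 2 ≤ k ≤ n−1: W_{n−k,1} = {x_{ℓ1}⋯x_{ℓ_{k−1}} x_i : 1 ≤ ℓ1 < ⋯ < ℓ_{k−1} ≤ n−2, ℓ_{k−1} < i ≤ n}; W_{n−k,2} = {x_{ℓ1}⋯x_{ℓ_{k−1}} x_{n−1} x_n : 1 ≤ ℓ1 < ⋯ < ℓ_{k−1} ≤ n−2} ∪ {x_{ℓ1}⋯x_{ℓ_{k−1}} x_n x_{n−1} : 1 ≤ ℓ1 < ⋯ < ℓ_{k−1} ≤ n−2}; W_{n−2,3} = {x_{n−1}x_{n−2}x_n} and, for k ≥ 3, W_{n−k,3} = {x_{ℓ1}⋯x_{ℓ_{k−2}} x_{n−1}x_{n−2}x_n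 : 1 ≤ ℓ1 < ⋯ < ℓ_{k−2} ≤ n−2}; W_{n−k,4} = {x_{ℓ1}⋯x_{ℓ_{k−i}} x_{n−1}^i : i ≤ ℓ1 < ⋯ < ℓ_{k−i} ≤ n−2, 2 ≤ i < k} ∪ {x_{n−1}^k}; W_{n−k,5} = {x_{ℓ1}⋯x_{ℓ_{k−i}} x_n^i : 1 ≤ ℓ1 < ⋯ < ℓ_{k−i} ≤ n−i−1, 2 ≤ i < k} ∪ {x_n^k}; W_{n−k,6} = {x_{ℓ1}⋯x_{ℓ_{k−i}} x_{n−1}^{i−1} x_{n−i} : i−1 ≤ ℓ1 < ⋯ < ℓ_{k−i} ≤ n−2, 2 ≤ i < k} ∪ {x_{n−1}^{k−1} x_{n−k}}; W_{n−k,7} = {x_{ℓ1}⋯x_{ℓ_{k−i}} x_n x_1 x_n^{i−2} : 1 ≤ ℓ1 < ⋯ < ℓ_{k−i} ≤ n−i, 2 ≤ i < k} ∪ {x_n x_1 x_n^{k−2}}; W_{n−k} = W_{n−k,1} ∪ ⋯ ∪ W_{n−k,7}; and W_0 = {x_n^n}. Let W = {1} ∪ W_0 ∪ W_1 ∪ ⋯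 ∪ W_{n−1} (where 1 is the empty word). Then W is a set of forms for ⟨A | R⟩: for every word w ∈ A* there exists w' ∈ W with (w, w') ∈ ρ_R. -/
namespace PIso

/-- The letter `x_i` (for `1 ≤ i ≤ n`) of an alphabet with `n` letters. -/
def ltr (n i : ℕ) : FreeMonoid (Fin n) :=
  if h : 0 < n then FreeMonoid.of ⟨(i - 1) % n, Nat.mod_lt _ h⟩ else 1

/-- The word `x_{L₁} x_{L₂} ⋯` associated to a list `L` of indices. -/
def wordOf {β : Type*} (x : ℕ → FreeMonoid β) (L : List ℕ) : FreeMonoid β :=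
  (L.map x).prod

/-- The word `x_1 x_2 ⋯ x_m`. -/
def wordUp {β : Type*} (x : ℕ → FreeMonoid β) (m : ℕ) : FreeMonoid β :=
  wordOf x ((List.range m).map (· + 1))

/-- The word `x_m x_{m-1} ⋯ x_1`. -/
def wordDown {β : Type*} (x : ℕ → FreeMonoid β) (m : ℕ) : FreeMonoid β :=
  wordOf x ((List.range m).map (fun t => m - t))

/-- The relations (R1)–(R12), written using an arbitrary assignment `x` of letters
to the indices `1,…,n`. -/
def RrelGen {β : Type*} (x : ℕ → FreeMonoid β) (n : ℕ) (u v : FreeMonoid β) : Prop :=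
  -- (R1)
  (∃ i, 1 ≤ i ∧ i ≤ n - 2 ∧ u = x i * x i ∧ v = x i) ∨
  -- (R2)
  (∃ i j, 1 ≤ i ∧ i < j ∧ j ≤ n - 2 ∧ u = x i * x j ∧ v = x j * x i) ∨
  -- (R3)
  (∃ i, 1 ≤ i ∧ i ≤ n - 3 ∧ u = x (n-1) * x i ∧ v = x (i+1) * x (n-1)) ∨
  -- (R4)
  (∃ i, 1 ≤ i ∧ i ≤ n - 3 ∧ u = x n * x (i+1) ∧ v = x i * x n) ∨
  -- (R5)
  (u = x (n-1) ^ 2 * x n ∧ v = x 1 * x (n-1)) ∨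
  -- (R6)
  (u = x n * x (n-1) ^ 2 ∧ v = x (n-1) * x (n-2)) ∨
  -- (R7)
  (u = x n ^ 2 * x (n-1) ∧ v = x (n-2) * x n) ∨
  -- (R8)
  (u = x (n-1) * x n ^ 2 ∧ v = x n * x 1) ∨
  -- (R9)
  (u = x (n-1) * x n * x (n-1) ∧ v = x (n-1)) ∨
  -- (R10)
  (u = x n * x (n-1) * x n ∧ v = x n) ∨
  -- (R11)
  (u = x n ^ n ∧ v = wordUp x (n-2) * x (n-1) * x (n-2)) ∨
  -- (R12)
  (u = x n ^ (n+1) ∧ v = x n ^ n)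

/-- The set `R` of relations (R1)–(R12) over the alphabet `A = {x_1,…,x_n}`. -/
def Rrel (n : ℕ) : FreeMonoid (Fin n) → FreeMonoid (Fin n) → Prop :=
  RrelGen (ltr n) n

/-! Words over the alphabet `B = A ∪ {h}`, which we realize as `Fin (n+1)`:
the indices `0,…,n-1` are the letters `x_1,…,x_n` and the index `n` is the letter `h`. -/

/-- The letter `x_i` (for `1 ≤ i ≤ n`) of the alphabet `B`. -/
def ltrB (n i : ℕ) : FreeMonoid (Fin (n+1)) :=
  FreeMonoid.of ⟨(i - 1) % (n + 1), Nat.mod_lt _ (Nat.succ_pos n)⟩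

/-- The letter `h` of the alphabet `B`. -/
def hltr (n : ℕ) : FreeMonoid (Fin (n+1)) :=
  FreeMonoid.of ⟨n, Nat.lt_succ_self n⟩

/-- The set `R̄` of relations over the alphabet `B`: (R1)–(R12) together with
(NR0) `h² = 1`, (NR1) `h x_{n-1} = x_n h`, `h x_n = x_{n-1} h`, `h x_i = x_{n-i-1} h`
for `1 ≤ i ≤ n-2`, and (NR2) `x_n^{n-1} h = x_n x_{n-1} ⋯ x_2 x_1`. -/
def RbarRel (n : ℕ) (u v : FreeMonoid (Fin (n+1))) : Prop :=
  RrelGen (ltrB n) n u v ∨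
  -- (NR0)
  (u = hltr n * hltr n ∧ v = 1) ∨
  -- (NR1)
  (u = hltr n * ltrB n (n-1) ∧ v = ltrB n n * hltr n) ∨
  (u = hltr n * ltrB n n ∧ v = ltrB n (n-1) * hltr n) ∨
  (∃ i, 1 ≤ i ∧ i ≤ n - 2 ∧ u = hltr n * ltrB n i ∧ v = ltrB n (n-i-1) * hltr n) ∨
  -- (NR2)
  (u = ltrB n n ^ (n-1) * hltr n ∧ v = ltrB n n * wordDown (ltrB n) (n-1))

/-- The set `U` of relations over the alphabet `B`. -/
def Urel (n : ℕ) (u v : FreeMonoid (Fin (n+1))) : Prop :=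
  -- (R̄1)
  (∃ i, 1 ≤ i ∧ i ≤ (n-1)/2 ∧ u = ltrB n i * ltrB n i ∧ v = ltrB n i) ∨
  -- (R2)
  (∃ i j, 1 ≤ i ∧ i < j ∧ j ≤ n - 2 ∧ u = ltrB n i * ltrB n j ∧ v = ltrB n j * ltrB n i) ∨
  -- (R4)
  (∃ i, 1 ≤ i ∧ i ≤ n - 3 ∧ u = ltrB n n * ltrB n (i+1) ∧ v = ltrB n i * ltrB n n) ∨
  -- (R̄7)
  (u = ltrB n n ^ 2 * hltr n * ltrB n n * hltr n ∧ v = hltr n * ltrB n 1 * hltr n * ltrB n n) ∨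
  -- (R̄8)
  (u = hltr n * ltrB n n * hltr n * ltrB n n ^ 2 ∧ v = ltrB n n * ltrB n 1) ∨
  -- (R̄10)
  (u = ltrB n n * hltr n * ltrB n n * hltr n * ltrB n n ∧ v = ltrB n n) ∨
  -- (R11)
  (u = ltrB n n ^ n ∧ v = wordUp (ltrB n) (n-2) * ltrB n (n-1) * ltrB n (n-2)) ∨
  -- (R12)
  (u = ltrB n n ^ (n+1) ∧ v = ltrB n n ^ n) ∨
  -- (NR0)
  (u = hltr n * hltr n ∧ v = 1) ∨
  -- (NR̄1)
  (u = hltr n * ltrB n n ∧ v = ltrB n (n-1) * hltr n) ∨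
  (∃ i, 1 ≤ i ∧ i ≤ (n-1)/2 ∧ u = hltr n * ltrB n i ∧ v = ltrB n (n-i-1) * hltr n) ∨
  -- (NR2)
  (u = ltrB n n ^ (n-1) * hltr n ∧ v = ltrB n n * wordDown (ltrB n) (n-1))

end PIso
namespace PIso

/-- `L` is a strictly increasing list of indices within `{lo,…,hi}`. -/
def IsAsc (lo hi : ℕ) (L : List ℕ) : Prop :=
  L.Chain' (· < ·) ∧ ∀ a ∈ L, lo ≤ a ∧ a ≤ hi

/-- The set `W_{n-k,1}`. -/
def W1 (n k : ℕ) : Set (FreeMonoid (Fin n)) :=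
  {w | ∃ L i, IsAsc 1 (n - 2) L ∧ L.length = k - 1 ∧ (∀ a ∈ L, a < i) ∧ i ≤ n ∧
    w = wordOf (ltr n) L * ltr n i}

/-- The set `W_{n-k,2}`. -/
def W2 (n k : ℕ) : Set (FreeMonoid (Fin n)) :=
  {w | ∃ L, IsAsc 1 (n - 2) L ∧ L.length = k - 1 ∧
    (w = wordOf (ltr n) L * ltr n (n-1) * ltr n n ∨
     w = wordOf (ltr n) L * ltr n n * ltr n (n-1))}

/-- The set `W_{n-k,3}` (for `k = 2` this is the singleton `{x_{n-1} x_{n-2} x_n}`). -/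
def W3 (n k : ℕ) : Set (FreeMonoid (Fin n)) :=
  {w | ∃ L, IsAsc 1 (n - 2) L ∧ L.length = k - 2 ∧
    w = wordOf (ltr n) L * ltr n (n-1) * ltr n (n-2) * ltr n n}

/-- The set `W_{n-k,4}`. -/
def W4 (n k : ℕ) : Set (FreeMonoid (Fin n)) :=
  {w | (∃ i L, 2 ≤ i ∧ i < k ∧ IsAsc i (n - 2) L ∧ L.length = k - i ∧
          w = wordOf (ltr n) L * ltr n (n-1) ^ i) ∨
       w = ltr n (n-1) ^ k}

/-- The set `W_{n-k,5}`. -/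
def W5 (n k : ℕ) : Set (FreeMonoid (Fin n)) :=
  {w | (∃ i L, 2 ≤ i ∧ i < k ∧ IsAsc 1 (n - i - 1) L ∧ L.length = k - i ∧
          w = wordOf (ltr n) L * ltr n n ^ i) ∨
       w = ltr n n ^ k}

/-- The set `W_{n-k,6}`. -/
def W6 (n k : ℕ) : Set (FreeMonoid (Fin n)) :=
  {w | (∃ i L, 2 ≤ i ∧ i < k ∧ IsAsc (i - 1) (n - 2) L ∧ L.length = k - i ∧
          w = wordOf (ltr n) L * ltr n (n-1) ^ (i-1) * ltr n (n-i)) ∨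
       w = ltr n (n-1) ^ (k-1) * ltr n (n-k)}

/-- The set `W_{n-k,7}`. -/
def W7 (n k : ℕ) : Set (FreeMonoid (Fin n)) :=
  {w | (∃ i L, 2 ≤ i ∧ i < k ∧ IsAsc 1 (n - i) L ∧ L.length = k - i ∧
          w = wordOf (ltr n) L * ltr n n * ltr n 1 * ltr n n ^ (i-2)) ∨
       w = ltr n n * ltr n 1 * ltr n n ^ (k-2)}

/-- The set of forms `W = {1} ∪ W_0 ∪ W_1 ∪ ⋯ ∪ W_{n-1}` for `⟨A | R⟩`, where
`W_{n-1} = {x_1,…,x_n, x_{n-1}x_n, x_n x_{n-1}}`, `W_0 = {x_n^n}`, and for `2 ≤ k ≤ n-1`,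
`W_{n-k} = W_{n-k,1} ∪ ⋯ ∪ W_{n-k,7}`. -/
def Wforms (n : ℕ) : Set (FreeMonoid (Fin n)) :=
  {w | w = 1 ∨ w = ltr n n ^ n ∨
       (∃ i, 1 ≤ i ∧ i ≤ n ∧ w = ltr n i) ∨
       w = ltr n (n-1) * ltr n n ∨ w = ltr n n * ltr n (n-1) ∨
       ∃ k, 2 ≤ k ∧ k ≤ n - 1 ∧
         (w ∈ W1 n k ∨ w ∈ W2 n k ∨ w ∈ W3 n k ∨ w ∈ W4 n k ∨ w ∈ W5 n k ∨
          w ∈ W6 n k ∨ w ∈ W7 n k)}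

end PIso

namespace PIso

section Algebra

variable {M : Type*} [Monoid M]

/-- Generators `x`, `y` and commuting idempotents `e 0, …, e (n - 1)` which multiply like the
order-preserving partial isometries of the chain `0 < ⋯ < n - 1`: `e i` removes the point `i`,
`x` shifts down and `y` shifts up. For convenience `e i = 1` when `n ≤ i`. -/
structure ShiftSystem (n : ℕ) (x y : M) (e : ℕ → M) : Prop where
  comm : ∀ i j, Commute (e i) (e j)
  idem : ∀ i, e i * e i = e i
  eq_one : ∀ i, n ≤ i → e i = 1
  x_e : ∀ i, i + 1 < n → x * e i = e (i + 1) * x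
  y_e : ∀ i, i + 1 < n → y * e (i + 1) = e i * y
  x_last : x * e (n - 1) = x
  y_zero : y * e 0 = y
  zero_x : e 0 * x = x
  last_y : e (n - 1) * y = y
  x_y : x * y = e 0
  y_x : y * x = e (n - 1)

/-- The product of the elements `e i` over `i ∈ S`. -/
def finProd {e : ℕ → M} (hc : ∀ i j, Commute (e i) (e j)) (S : Finset ℕ) : M :=
  S.noncommProd e fun i _ j _ _ => hc i j

section finProd

variable {e : ℕ → M} (hc : ∀ i j, Commute (e i) (e j))

lemma finProd_empty : finProd hc ∅ = 1 := Finset.noncommProd_empty _ _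

lemma finProd_toFinset {L : List ℕ} (hL : L.Nodup) :
    finProd hc L.toFinset = (L.map e).prod :=
  Finset.noncommProd_toFinset _ _ _ hL

lemma finProd_comm (i : ℕ) (S : Finset ℕ) : e i * finProd hc S = finProd hc S * e i :=
  Finset.noncommProd_commute _ _ _ _ fun j _ => hc i j

lemma finProd_insert (hi : ∀ i, e i * e i = e i) (i : ℕ) (S : Finset ℕ) :
    finProd hc (insert i S) = e i * finProd hc S := by
  have key : ∀ T : Finset ℕ, i ∉ T → finProd hc (insert i T) = e i * finProd hc T :=
    fun T hT => Finset.noncommProd_insert_of_notMem _ _ _ _ hT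
  by_cases h : i ∈ S
  · rw [← Finset.insert_erase h, Finset.insert_idem, key _ (Finset.notMem_erase _ _),
      ← mul_assoc, hi]
  · exact key S h

lemma finProd_union_mul (hi : ∀ i, e i * e i = e i) (S T : Finset ℕ) {u : M}
    (hT : ∀ i ∈ T, i ∈ S ∨ e i * u = u) : finProd hc (S ∪ T) * u = finProd hc S * u := by
  induction T using Finset.induction_on with
  | empty => simp
  | insert i T _ ih =>
    have ih := ih fun j hj => hT j (Finset.mem_insert_of_mem hj)
    rcases hT i (Finset.mem_insert_self _ _) with h | h
    · rwa [Finset.union_insert, Finset.insert_eq_of_mem (Finset.mem_union_left _ h)]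
    · rw [Finset.union_insert, finProd_insert hc hi, finProd_comm, mul_assoc, h, ih]

lemma finProd_mul_eq (hi : ∀ i, e i * e i = e i) {S T : Finset ℕ} {u : M}
    (hS : ∀ i ∈ S, i ∈ T ∨ e i * u = u) (hT : ∀ i ∈ T, i ∈ S ∨ e i * u = u) :
    finProd hc S * u = finProd hc T * u := by
  rw [← finProd_union_mul hc hi S T hT, Finset.union_comm, finProd_union_mul hc hi T S hS]

end finProd

namespace ShiftSystem

variable {n : ℕ} {x y : M} {e : ℕ → M}

lemma x_finProd (h : ShiftSystem n x y e) (S : Finset ℕ) :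
    ∃ S', x * finProd h.comm S = finProd h.comm S' * x := by
  induction S using Finset.induction_on with
  | empty => exact ⟨∅, by simp [finProd_empty]⟩
  | insert i S _ ih =>
    obtain ⟨S', hS'⟩ := ih
    rw [finProd_insert h.comm h.idem, ← mul_assoc]
    rcases lt_trichotomy (i + 1) n with hi | hi | hi
    · exact ⟨insert (i + 1) S', by
        rw [h.x_e i hi, mul_assoc, hS', finProd_insert h.comm h.idem, mul_assoc]⟩
    · obtain rfl : i = n - 1 := by omega
      exact ⟨S', by rw [h.x_last, hS']⟩
    · exact ⟨S', by rw [h.eq_one i (by omega), mul_one, hS']⟩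

lemma y_finProd (h : ShiftSystem n x y e) (S : Finset ℕ) :
    ∃ S', y * finProd h.comm S = finProd h.comm S' * y := by
  induction S using Finset.induction_on with
  | empty => exact ⟨∅, by simp [finProd_empty]⟩
  | insert i S _ ih =>
    obtain ⟨S', hS'⟩ := ih
    rw [finProd_insert h.comm h.idem, ← mul_assoc]
    rcases i with _ | i
    · exact ⟨S', by rw [h.y_zero, hS']⟩
    rcases lt_or_ge (i + 1) n with hi | hi
    · exact ⟨insert i S', by
        rw [h.y_e i hi, mul_assoc, hS', finProd_insert h.comm h.idem, mul_assoc]⟩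
    · exact ⟨S', by rw [h.eq_one (i + 1) hi, mul_one, hS']⟩

/-- The elements of the form `e_S x^i` or `e_S y^i`. -/
def IsNormal (h : ShiftSystem n x y e) (m : M) : Prop :=
  ∃ S i, m = finProd h.comm S * x ^ i ∨ m = finProd h.comm S * y ^ i

lemma isNormal_one (h : ShiftSystem n x y e) : h.IsNormal 1 :=
  ⟨∅, 0, by simp [finProd_empty]⟩

lemma IsNormal.e_mul {h : ShiftSystem n x y e} {m : M} (hm : h.IsNormal m) (j : ℕ) :
    h.IsNormal (e j * m) := by
  obtain ⟨S, i, rfl | rfl⟩ := hm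
  · exact ⟨insert j S, i, .inl (by rw [finProd_insert h.comm h.idem, mul_assoc])⟩
  · exact ⟨insert j S, i, .inr (by rw [finProd_insert h.comm h.idem, mul_assoc])⟩

lemma IsNormal.finProd_mul {h : ShiftSystem n x y e} {m : M} (hm : h.IsNormal m)
    (S : Finset ℕ) : h.IsNormal (finProd h.comm S * m) := by
  induction S using Finset.induction_on with
  | empty => simpa [finProd_empty] using hm
  | insert j S _ ih =>
    rw [finProd_insert h.comm h.idem, mul_assoc]
    exact ih.e_mul j

lemma IsNormal.x_mul {h : ShiftSystem n x y e} {m : M} (hm : h.IsNormal m) :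
    h.IsNormal (x * m) := by
  obtain ⟨S, i, rfl | rfl⟩ := hm <;> obtain ⟨S', hS'⟩ := h.x_finProd S <;>
    rw [← mul_assoc, hS', mul_assoc]
  · exact ⟨S', i + 1, .inl (by rw [pow_succ'])⟩
  · rcases i with _ | i
    · exact ⟨S', 1, .inl (by simp)⟩
    · rw [pow_succ', ← mul_assoc x, h.x_y]
      exact (IsNormal.e_mul ⟨∅, i, .inr (by simp [finProd_empty])⟩ 0).finProd_mul S'

lemma IsNormal.y_mul {h : ShiftSystem n x y e} {m : M} (hm : h.IsNormal m) :
    h.IsNormal (y * m) := by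
  obtain ⟨S, i, rfl | rfl⟩ := hm <;> obtain ⟨S', hS'⟩ := h.y_finProd S <;>
    rw [← mul_assoc, hS', mul_assoc]
  · rcases i with _ | i
    · exact ⟨S', 1, .inr (by simp)⟩
    · rw [pow_succ', ← mul_assoc y, h.y_x]
      exact (IsNormal.e_mul ⟨∅, i, .inl (by simp [finProd_empty])⟩ _).finProd_mul S'
  · exact ⟨S', i + 1, .inr (by rw [pow_succ'])⟩

lemma x_pow_e (h : ShiftSystem n x y e) (i j : ℕ) (hij : i + j < n) :
    x ^ i * e j = e (i + j) * x ^ i := by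
  induction i generalizing j with
  | zero => simp
  | succ i ih =>
    rw [pow_succ, mul_assoc, h.x_e j (by omega), ← mul_assoc, ih (j + 1) (by omega), mul_assoc]
    congr 2
    omega

lemma e_x_pow (h : ShiftSystem n x y e) {i j : ℕ} (hji : j < i) :
    e j * x ^ i = x ^ i := by
  rcases lt_or_ge j n with hj | hj
  · obtain ⟨d, rfl⟩ := Nat.exists_eq_add_of_lt hji
    rw [show j + d + 1 = j + (d + 1) by omega, pow_add, ← mul_assoc]
    have := h.x_pow_e j 0 (by omega)
    rw [add_zero] at this
    rw [← this, mul_assoc, pow_succ', ← mul_assoc (e 0), h.zero_x]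
  · rw [h.eq_one j hj, one_mul]

lemma y_pow_e (h : ShiftSystem n x y e) (i j : ℕ) (hij : i + j < n) :
    y ^ i * e (i + j) = e j * y ^ i := by
  induction i generalizing j with
  | zero => simp
  | succ i ih =>
    rw [pow_succ, mul_assoc, show i + 1 + j = (i + j) + 1 by omega, h.y_e _ (by omega),
      ← mul_assoc, ih j (by omega), mul_assoc]

lemma e_y_pow (h : ShiftSystem n x y e) {i j : ℕ} (hji : n ≤ i + j) :
    e j * y ^ i = y ^ i := by
  rcases lt_or_ge j n with hj | hj
  · obtain ⟨d, rfl⟩ : ∃ d, i = (n - 1 - j) + (d + 1) := ⟨i - (n - 1 - j) - 1, by omega⟩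
    rw [pow_add, ← mul_assoc, ← h.y_pow_e (n - 1 - j) j (by omega), mul_assoc, pow_succ',
      show n - 1 - j + j = n - 1 by omega, ← mul_assoc (e _), h.last_y]
  · rw [h.eq_one j hj, one_mul]

lemma finProd_x_pow_eq (h : ShiftSystem n x y e) {S T : Finset ℕ} {i : ℕ}
    (H : ∀ j, i ≤ j → j < n → (j ∈ S ↔ j ∈ T)) :
    finProd h.comm S * x ^ i = finProd h.comm T * x ^ i := by
  have key : ∀ j, (j < i ∨ n ≤ j) → e j * x ^ i = x ^ i := by
    rintro j (hj | hj)
    · exact h.e_x_pow hj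
    · rw [h.eq_one j hj, one_mul]
  refine finProd_mul_eq h.comm h.idem ?_ ?_ <;> intro j hj <;>
    by_cases hji : j < i ∨ n ≤ j
  · exact .inr (key j hji)
  · exact .inl ((H j (by omega) (by omega)).1 hj)
  · exact .inr (key j hji)
  · exact .inl ((H j (by omega) (by omega)).2 hj)

lemma finProd_y_pow_eq (h : ShiftSystem n x y e) {S T : Finset ℕ} {i : ℕ}
    (H : ∀ j, i + j < n → (j ∈ S ↔ j ∈ T)) :
    finProd h.comm S * y ^ i = finProd h.comm T * y ^ i := by
  refine finProd_mul_eq h.comm h.idem ?_ ?_ <;> intro j hj <;>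
    rcases lt_or_ge (i + j) n with hji | hji
  · exact .inl ((H j hji).1 hj)
  · exact .inr (h.e_y_pow hji)
  · exact .inl ((H j hji).2 hj)
  · exact .inr (h.e_y_pow hji)

/-- If `e_0 ⋯ e_{n-1} x = y^n` and `y^{n+1} = y^n`, then `y^n` is a zero, equal to
`e_0 ⋯ e_{n-1}`. -/
lemma zero_facts (h : ShiftSystem n x y e)
    (hz : finProd h.comm (Finset.range n) * x = y ^ n) (hy : y ^ (n + 1) = y ^ n) (i : ℕ) :
    finProd h.comm (Finset.range n) * x ^ i = y ^ n ∧
      finProd h.comm (Finset.range n) * y ^ i = y ^ n := by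
  rcases Nat.eq_zero_or_pos n with rfl | hn
  · have hx : x = 1 := by simpa [finProd_empty] using hz
    have hy : y = 1 := by simpa using hy
    simp [hx, hy, finProd_empty]
  have h0 : finProd h.comm (Finset.range n) = y ^ n := by
    rw [← hy, pow_succ, ← hz, mul_assoc, h.x_y, ← finProd_comm, ← finProd_insert h.comm h.idem,
      Finset.insert_eq_of_mem (Finset.mem_range.2 hn)]
  constructor
  · induction i with
    | zero => simpa using h0
    | succ i ih => rw [pow_succ, ← mul_assoc, ih, ← h0, hz]; exact h0.symm
  · induction i with
    | zero => simpa using h0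
    | succ i ih => rw [pow_succ, ← mul_assoc, ih, ← pow_succ, hy]

end ShiftSystem

/-- The relations (R1)–(R10) for the images `a 1, …, a n` of the letters in a monoid. -/
structure BasicRelations (n : ℕ) (a : ℕ → M) : Prop where
  idem : ∀ i, 1 ≤ i → i ≤ n - 2 → a i * a i = a i
  comm : ∀ i j, 1 ≤ i → i < j → j ≤ n - 2 → a i * a j = a j * a i
  x_e : ∀ i, 1 ≤ i → i ≤ n - 3 → a (n - 1) * a i = a (i + 1) * a (n - 1)
  y_e : ∀ i, 1 ≤ i → i ≤ n - 3 → a n * a (i + 1) = a i * a n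
  xxy : a (n - 1) ^ 2 * a n = a 1 * a (n - 1)
  yxx : a n * a (n - 1) ^ 2 = a (n - 1) * a (n - 2)
  yyx : a n ^ 2 * a (n - 1) = a (n - 2) * a n
  xyy : a (n - 1) * a n ^ 2 = a n * a 1
  xyx : a (n - 1) * a n * a (n - 1) = a (n - 1)
  yxy : a n * a (n - 1) * a n = a n

/-- The idempotents removing a single point. -/
def pointIdem (n : ℕ) (a : ℕ → M) (j : ℕ) : M :=
  if j = 0 then a (n - 1) * a n else if j = n - 1 then a n * a (n - 1)
  else if j < n then a j else 1

lemma pointIdem_zero (n : ℕ) (a : ℕ → M) : pointIdem n a 0 = a (n - 1) * a n := if_pos rfl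

lemma pointIdem_last {n : ℕ} (hn : 3 ≤ n) (a : ℕ → M) :
    pointIdem n a (n - 1) = a n * a (n - 1) := by
  rw [pointIdem, if_neg (by omega), if_pos rfl]

lemma pointIdem_of_mem {n j : ℕ} (a : ℕ → M) (h1 : 1 ≤ j) (h2 : j ≤ n - 2) :
    pointIdem n a j = a j := by
  rw [pointIdem, if_neg (by omega), if_neg (by omega), if_pos (by omega)]

lemma pointIdem_of_le {n j : ℕ} (hn : 3 ≤ n) (a : ℕ → M) (h : n ≤ j) :
    pointIdem n a j = 1 := by
  rw [pointIdem, if_neg (by omega), if_neg (by omega), if_neg (by omega)]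

namespace BasicRelations

variable {n : ℕ} {a : ℕ → M}

lemma zero_comm_mid (h : BasicRelations n a) {j : ℕ} (h1 : 1 ≤ j) (h2 : j ≤ n - 2) :
    a (n - 1) * a n * a j = a j * (a (n - 1) * a n) := by
  rcases eq_or_lt_of_le h1 with rfl | h1
  · rw [mul_assoc, ← h.xyy, ← mul_assoc (a 1), ← h.xxy]
    simp only [pow_two, mul_assoc]
  · obtain ⟨i, rfl⟩ : ∃ i, j = i + 1 := ⟨j - 1, by omega⟩
    rw [mul_assoc, h.y_e i (by omega) (by omega), ← mul_assoc, h.x_e i (by omega) (by omega),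
      mul_assoc]

lemma last_comm_mid (h : BasicRelations n a) {j : ℕ} (h1 : 1 ≤ j) (h2 : j ≤ n - 2) :
    a n * a (n - 1) * a j = a j * (a n * a (n - 1)) := by
  rcases eq_or_lt_of_le h2 with rfl | h2
  · rw [mul_assoc, ← h.yxx, ← mul_assoc (a (n - 2)), ← h.yyx]
    simp only [pow_two, mul_assoc]
  · rw [mul_assoc, h.x_e j (by omega) (by omega), ← mul_assoc, h.y_e j (by omega) (by omega),
      mul_assoc]

lemma zero_comm_last (h : BasicRelations n a) :
    a (n - 1) * a n * (a n * a (n - 1)) = a n * a (n - 1) * (a (n - 1) * a n) := by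
  have h1 : a (n - 1) * a n * (a n * a (n - 1)) = a (n - 1) * (a n ^ 2 * a (n - 1)) := by
    simp only [pow_two, mul_assoc]
  have h2 : a n * a (n - 1) * (a (n - 1) * a n) = a n * a (n - 1) ^ 2 * a n := by
    simp only [pow_two, mul_assoc]
  rw [h1, h2, h.yxx, h.yyx, mul_assoc]

lemma pointIdem_comm (h : BasicRelations n a) (hn : 3 ≤ n) (i j : ℕ) :
    Commute (pointIdem n a i) (pointIdem n a j) := by
  wlog hij : i ≤ j generalizing i j
  · exact (this j i (by omega)).symm
  rcases eq_or_lt_of_le hij with rfl | hij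
  · exact Commute.refl _
  rcases lt_or_ge j n with hj | hj
  swap
  · rw [pointIdem_of_le hn a hj]
    exact Commute.one_right _
  rcases Nat.eq_zero_or_pos i with rfl | hi <;> rcases eq_or_ne j (n - 1) with rfl | hj'
  · rw [pointIdem_zero, pointIdem_last hn]
    exact h.zero_comm_last
  · rw [pointIdem_zero, pointIdem_of_mem a (by omega) (by omega)]
    exact h.zero_comm_mid (by omega) (by omega)
  · rw [pointIdem_last hn, pointIdem_of_mem a (by omega) (by omega)]
    exact (h.last_comm_mid (by omega) (by omega)).symm
  · rw [pointIdem_of_mem a (by omega) (by omega), pointIdem_of_mem a (by omega) (by omega)]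
    exact h.comm i j (by omega) (by omega) (by omega)

lemma shiftSystem (h : BasicRelations n a) (hn : 3 ≤ n) :
    ShiftSystem n (a (n - 1)) (a n) (pointIdem n a) where
  comm := h.pointIdem_comm hn
  idem i := by
    rcases lt_or_ge i n with hi | hi
    · rcases Nat.eq_zero_or_pos i with rfl | h0
      · rw [pointIdem_zero, ← mul_assoc, h.xyx]
      rcases eq_or_ne i (n - 1) with rfl | h1
      · rw [pointIdem_last hn, ← mul_assoc, h.yxy]
      · rw [pointIdem_of_mem a (by omega) (by omega), h.idem i (by omega) (by omega)]
    · rw [pointIdem_of_le hn a hi, one_mul]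
  eq_one i hi := pointIdem_of_le hn a hi
  x_e i hi := by
    rcases Nat.eq_zero_or_pos i with rfl | h0
    · rw [pointIdem_zero, pointIdem_of_mem a (by omega) (by omega), ← h.xxy, pow_two, mul_assoc]
    rw [pointIdem_of_mem (j := i) a (by omega) (by omega)]
    rcases eq_or_ne (i + 1) (n - 1) with h1 | h1
    · rw [h1, pointIdem_last hn, show i = n - 2 by omega, ← h.yxx, pow_two, mul_assoc]
    · rw [pointIdem_of_mem a (by omega) (by omega), h.x_e i (by omega) (by omega)]
  y_e i hi := by
    rcases Nat.eq_zero_or_pos i with rfl | h0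
    · rw [pointIdem_zero, pointIdem_of_mem a (by omega) (by omega), ← h.xyy, pow_two, mul_assoc]
    rw [pointIdem_of_mem (j := i) a (by omega) (by omega)]
    rcases eq_or_ne (i + 1) (n - 1) with h1 | h1
    · rw [h1, pointIdem_last hn, show i = n - 2 by omega, ← h.yyx, pow_two, mul_assoc]
    · rw [pointIdem_of_mem a (by omega) (by omega), h.y_e i (by omega) (by omega)]
  x_last := by rw [pointIdem_last hn, ← mul_assoc, h.xyx]
  y_zero := by rw [pointIdem_zero, ← mul_assoc, h.yxy]
  zero_x := by rw [pointIdem_zero, h.xyx]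
  last_y := by rw [pointIdem_last hn, h.yxy]
  x_y := (pointIdem_zero n a).symm
  y_x := (pointIdem_last hn a).symm

lemma finProd_range_mul (h : BasicRelations n a) (hn : 3 ≤ n) :
    finProd (h.pointIdem_comm hn) (Finset.range n) * a (n - 1) =
      (((List.range (n - 2)).map (· + 1)).map a).prod * a (n - 1) * a (n - 2) := by
  have hs := h.shiftSystem hn
  set L := (List.range (n - 2)).map (· + 1) with hL
  have hmem : ∀ j, j ∈ L ↔ 1 ≤ j ∧ j ≤ n - 2 := by
    intro j
    simp only [hL, List.mem_map, List.mem_range]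
    exact ⟨by rintro ⟨t, ht, rfl⟩; omega, fun hj => ⟨j - 1, by omega, by omega⟩⟩
  have hnd : L.Nodup := List.nodup_range.map (add_left_injective 1)
  have hmap : L.map a = L.map (pointIdem n a) :=
    List.map_congr_left fun j hj =>
      (pointIdem_of_mem a ((hmem j).1 hj).1 ((hmem j).1 hj).2).symm
  have hx : a (n - 1) * a (n - 2) = pointIdem n a (n - 1) * a (n - 1) := by
    have := hs.x_e (n - 2) (by omega)
    rwa [pointIdem_of_mem a (by omega) le_rfl, show n - 2 + 1 = n - 1 by omega] at this
  rw [mul_assoc, hx, hmap, ← finProd_toFinset hs.comm hnd, ← mul_assoc, ← finProd_comm,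
    ← finProd_insert hs.comm hs.idem]
  have := hs.finProd_x_pow_eq (i := 1) (S := Finset.range n)
    (T := insert (n - 1) L.toFinset) (fun j h1 h2 => by
      simp only [Finset.mem_range, Finset.mem_insert, List.mem_toFinset, hmem]
      omega)
  simpa using this

end BasicRelations

end Algebra

section Forms

lemma wordOf_nil {β : Type*} (x : ℕ → FreeMonoid β) : wordOf x [] = 1 := rfl

lemma IsAsc.nodup {lo hi : ℕ} {L : List ℕ} (h : IsAsc lo hi L) : L.Nodup :=
  (List.isChain_iff_pairwise.1 h.1).imp fun hab => ne_of_lt hab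

lemma IsAsc.length_le {lo hi : ℕ} {L : List ℕ} (h : IsAsc lo hi L) :
    L.length ≤ hi + 1 - lo := by
  rw [← List.toFinset_card_of_nodup h.nodup, ← Nat.card_Icc]
  refine Finset.card_le_card fun a ha => ?_
  rw [List.mem_toFinset] at ha
  exact Finset.mem_Icc.2 (h.2 a ha)

lemma isAsc_sort {lo hi : ℕ} {T : Finset ℕ} (h : ∀ a ∈ T, lo ≤ a ∧ a ≤ hi) :
    IsAsc lo hi T.sort :=
  ⟨List.isChain_iff_pairwise.2 T.sortedLT_sort.pairwise,
    fun a ha => h a ((Finset.mem_sort _).1 ha)⟩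

variable {n : ℕ} {L : List ℕ}

lemma wordOf_mem_Wforms (h : IsAsc 1 (n - 2) L) : wordOf (ltr n) L ∈ Wforms n := by
  rcases L.eq_nil_or_concat' with rfl | ⟨K, i, rfl⟩
  · exact .inl rfl
  have hi := h.2 i (by simp)
  have hp := List.pairwise_append.1 (List.isChain_iff_pairwise.1 h.1)
  have hlen := h.length_le
  rw [List.length_append, List.length_singleton] at hlen
  have hw : wordOf (ltr n) (K ++ [i]) = wordOf (ltr n) K * ltr n i := by simp [wordOf]
  rw [hw]
  rcases K.eq_nil_or_concat' with rfl | ⟨K', j, hK⟩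
  · exact .inr (.inr (.inl ⟨i, hi.1, by omega, by rw [wordOf_nil, one_mul]⟩))
  · have hK0 : 1 ≤ K.length := by simp [hK]
    exact .inr (.inr (.inr (.inr (.inr ⟨K.length + 1, by omega, by omega, .inl
      ⟨K, i, ⟨List.isChain_iff_pairwise.2 hp.1, fun a ha => h.2 a (by simp [ha])⟩, rfl,
        fun a ha => hp.2.2 a ha i (by simp), by omega, rfl⟩⟩))))

lemma wordOf_mul_ltr_mem_Wforms (hn : 3 ≤ n) (h : IsAsc 1 (n - 2) L) {i : ℕ}
    (hi : n - 1 ≤ i) (hin : i ≤ n) : wordOf (ltr n) L * ltr n i ∈ Wforms n := by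
  have hlen := h.length_le
  rcases Nat.eq_zero_or_pos L.length with h0 | h0
  · rw [List.length_eq_zero_iff] at h0
    subst h0
    exact .inr (.inr (.inl ⟨i, by omega, hin, by rw [wordOf_nil, one_mul]⟩))
  · exact .inr (.inr (.inr (.inr (.inr ⟨L.length + 1, by omega, by omega, .inl
      ⟨L, i, h, rfl, fun a ha => by have := h.2 a ha; omega, hin, rfl⟩⟩))))

lemma wordOf_mul_xy_mem_Wforms (hn : 3 ≤ n) (h : IsAsc 1 (n - 2) L) :
    wordOf (ltr n) L * ltr n (n - 1) * ltr n n ∈ Wforms n := by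
  have hlen := h.length_le
  rcases Nat.eq_zero_or_pos L.length with h0 | h0
  · rw [List.length_eq_zero_iff] at h0
    subst h0
    exact .inr (.inr (.inr (.inl (by rw [wordOf_nil, one_mul]))))
  · exact .inr (.inr (.inr (.inr (.inr ⟨L.length + 1, by omega, by omega, .inr (.inl
      ⟨L, h, rfl, .inl rfl⟩)⟩))))

lemma wordOf_mul_yx_mem_Wforms (hn : 3 ≤ n) (h : IsAsc 1 (n - 2) L) :
    wordOf (ltr n) L * ltr n n * ltr n (n - 1) ∈ Wforms n := by
  have hlen := h.length_le
  rcases Nat.eq_zero_or_pos L.length with h0 | h0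
  · rw [List.length_eq_zero_iff] at h0
    subst h0
    exact .inr (.inr (.inr (.inr (.inl (by rw [wordOf_nil, one_mul])))))
  · exact .inr (.inr (.inr (.inr (.inr ⟨L.length + 1, by omega, by omega, .inr (.inl
      ⟨L, h, rfl, .inr rfl⟩)⟩))))

lemma wordOf_mul_xey_mem_Wforms (h : IsAsc 1 (n - 2) L) (hlen : L.length + 3 ≤ n) :
    wordOf (ltr n) L * ltr n (n - 1) * ltr n (n - 2) * ltr n n ∈ Wforms n :=
  .inr (.inr (.inr (.inr (.inr ⟨L.length + 2, by omega, by omega, .inr (.inr (.inl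
    ⟨L, h, rfl, rfl⟩))⟩))))

lemma wordOf_mul_x_pow_mem_Wforms {i : ℕ} (hi : 2 ≤ i) (hin : i + 1 ≤ n)
    (h : IsAsc i (n - 2) L) : wordOf (ltr n) L * ltr n (n - 1) ^ i ∈ Wforms n := by
  have hlen := h.length_le
  refine .inr (.inr (.inr (.inr (.inr ⟨L.length + i, by omega, by omega,
    .inr (.inr (.inr (.inl ?_)))⟩))))
  rcases Nat.eq_zero_or_pos L.length with h0 | h0
  · rw [List.length_eq_zero_iff] at h0
    subst h0
    exact .inr (by rw [wordOf_nil, one_mul, List.length_nil, zero_add])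
  · exact .inl ⟨i, L, hi, by omega, h, by omega, rfl⟩

lemma wordOf_mul_y_pow_mem_Wforms {i : ℕ} (hi : 2 ≤ i) (hin : i + 1 ≤ n)
    (h : IsAsc 1 (n - i - 1) L) : wordOf (ltr n) L * ltr n n ^ i ∈ Wforms n := by
  have hlen := h.length_le
  refine .inr (.inr (.inr (.inr (.inr ⟨L.length + i, by omega, by omega,
    .inr (.inr (.inr (.inr (.inl ?_))))⟩))))
  rcases Nat.eq_zero_or_pos L.length with h0 | h0
  · rw [List.length_eq_zero_iff] at h0
    subst h0
    exact .inr (by rw [wordOf_nil, one_mul, List.length_nil, zero_add])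
  · exact .inl ⟨i, L, hi, by omega, h, by omega, rfl⟩

lemma wordOf_mul_x_pow_mul_mem_Wforms {i : ℕ} (hi : 1 ≤ i) (hlen : L.length + i + 2 ≤ n)
    (h : IsAsc i (n - 2) L) :
    wordOf (ltr n) L * ltr n (n - 1) ^ i * ltr n (n - (i + 1)) ∈ Wforms n := by
  refine .inr (.inr (.inr (.inr (.inr ⟨L.length + (i + 1), by omega, by omega,
    .inr (.inr (.inr (.inr (.inr (.inl ?_)))))⟩))))
  rcases Nat.eq_zero_or_pos L.length with h0 | h0
  · rw [List.length_eq_zero_iff] at h0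
    subst h0
    exact .inr (by rw [wordOf_nil, one_mul, List.length_nil, zero_add, Nat.add_sub_cancel])
  · exact .inl ⟨i + 1, L, by omega, by omega, h, by omega, rfl⟩

lemma wordOf_mul_y_mul_y_pow_mem_Wforms {i : ℕ} (hlen : L.length + i + 3 ≤ n)
    (h : IsAsc 1 (n - (i + 2)) L) :
    wordOf (ltr n) L * ltr n n * ltr n 1 * ltr n n ^ i ∈ Wforms n := by
  refine .inr (.inr (.inr (.inr (.inr ⟨L.length + (i + 2), by omega, by omega,
    .inr (.inr (.inr (.inr (.inr (.inr ?_)))))⟩))))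
  rcases Nat.eq_zero_or_pos L.length with h0 | h0
  · rw [List.length_eq_zero_iff] at h0
    subst h0
    exact .inr (by rw [wordOf_nil, one_mul, List.length_nil, zero_add, Nat.add_sub_cancel])
  · exact .inl ⟨i + 2, L, by omega, by omega, h, by omega, rfl⟩

end Forms

section Reduction

variable {M : Type*} [Monoid M] {n : ℕ} (φ : FreeMonoid (Fin n) →* M)

lemma map_wordOf (x : ℕ → FreeMonoid (Fin n)) (L : List ℕ) :
    φ (wordOf x L) = (L.map fun i => φ (x i)).prod := by
  rw [wordOf, map_list_prod, List.map_map]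
  rfl

variable {φ}

lemma basicRelations_of_Rrel (hφ : ∀ u v, Rrel n u v → φ u = φ v) :
    BasicRelations n fun i => φ (ltr n i) where
  idem i h1 h2 := by
    simpa using hφ _ _ (.inl ⟨i, h1, h2, rfl, rfl⟩)
  comm i j h1 h2 h3 := by
    simpa using hφ _ _ (.inr (.inl ⟨i, j, h1, h2, h3, rfl, rfl⟩))
  x_e i h1 h2 := by
    simpa using hφ _ _ (.inr (.inr (.inl ⟨i, h1, h2, rfl, rfl⟩)))
  y_e i h1 h2 := by
    simpa using hφ _ _ (.inr (.inr (.inr (.inl ⟨i, h1, h2, rfl, rfl⟩))))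
  xxy := by
    simpa using hφ _ _ (.inr (.inr (.inr (.inr (.inl ⟨rfl, rfl⟩)))))
  yxx := by
    simpa using hφ _ _ (.inr (.inr (.inr (.inr (.inr (.inl ⟨rfl, rfl⟩))))))
  yyx := by
    simpa using hφ _ _ (.inr (.inr (.inr (.inr (.inr (.inr (.inl ⟨rfl, rfl⟩)))))))
  xyy := by
    simpa using hφ _ _ (.inr (.inr (.inr (.inr (.inr (.inr (.inr (.inl ⟨rfl, rfl⟩))))))))
  xyx := by
    simpa using hφ _ _
      (.inr (.inr (.inr (.inr (.inr (.inr (.inr (.inr (.inl ⟨rfl, rfl⟩)))))))))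
  yxy := by
    simpa using hφ _ _
      (.inr (.inr (.inr (.inr (.inr (.inr (.inr (.inr (.inr (.inl ⟨rfl, rfl⟩))))))))))

/-- If `φ` respects the relations, then `φ (x_n^n)` equals `e_0 ⋯ e_{n-1} z` for every
power `z` of `φ x_{n-1}` or of `φ x_n`. -/
lemma finProd_range_mul_pow (hφ : ∀ u v, Rrel n u v → φ u = φ v)
    (h : BasicRelations n fun i => φ (ltr n i)) (hn : 3 ≤ n) (i : ℕ) :
    finProd (h.pointIdem_comm hn) (Finset.range n) * φ (ltr n (n - 1)) ^ i = φ (ltr n n ^ n) ∧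
      finProd (h.pointIdem_comm hn) (Finset.range n) * φ (ltr n n) ^ i = φ (ltr n n ^ n) := by
  rw [map_pow]
  refine (h.shiftSystem hn).zero_facts ?_ ?_ i
  · have hz := hφ _ _
      (.inr (.inr (.inr (.inr (.inr (.inr (.inr (.inr (.inr (.inr (.inl ⟨rfl, rfl⟩)))))))))))
    rw [wordUp, map_mul, map_mul, map_wordOf, map_pow] at hz
    rw [hz]
    exact h.finProd_range_mul hn
  · simpa using hφ _ _
      (.inr (.inr (.inr (.inr (.inr (.inr (.inr (.inr (.inr (.inr (.inr ⟨rfl, rfl⟩)))))))))))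

lemma map_wordOf_sort (h : BasicRelations n fun i => φ (ltr n i)) (hn : 3 ≤ n)
    {T : Finset ℕ} (hT : ∀ a ∈ T, 1 ≤ a ∧ a ≤ n - 2) :
    φ (wordOf (ltr n) T.sort) = finProd (h.pointIdem_comm hn) T := by
  conv_rhs => rw [← Finset.sort_toFinset (r := (· ≤ ·)) T]
  rw [map_wordOf, finProd_toFinset _ (Finset.sort_nodup _ _)]
  congr 1
  refine List.map_congr_left fun j hj => ?_
  have := hT j ((Finset.mem_sort _).1 hj)
  rw [pointIdem_of_mem _ this.1 this.2]

lemma exists_mem_Wforms_finProd (hφ : ∀ u v, Rrel n u v → φ u = φ v)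
    (h : BasicRelations n fun i => φ (ltr n i)) (hn : 3 ≤ n) (S : Finset ℕ) :
    ∃ w ∈ Wforms n, φ w = finProd (h.pointIdem_comm hn) S := by
  have hs := h.shiftSystem hn
  have key : ∀ T : Finset ℕ, (∀ j < n, j ∈ S ↔ j ∈ T) →
      finProd (h.pointIdem_comm hn) S = finProd (h.pointIdem_comm hn) T := fun T hT => by
    simpa using hs.finProd_x_pow_eq (i := 0) (S := S) (T := T) fun j _ hj => hT j hj
  by_cases hfull : ∀ j < n, j ∈ S
  · refine ⟨ltr n n ^ n, .inr (.inl rfl), ?_⟩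
    rw [key (Finset.range n) fun j hj => by simp [hj, hfull j hj]]
    simpa using ((finProd_range_mul_pow hφ h hn 0).1).symm
  push Not at hfull
  obtain ⟨j₀, hj₀, hj₀S⟩ := hfull
  set T := S.filter fun j => 1 ≤ j ∧ j ≤ n - 2 with hTdef
  have hT : ∀ a ∈ T, 1 ≤ a ∧ a ≤ n - 2 := fun a ha => (Finset.mem_filter.1 ha).2
  have hasc := isAsc_sort hT
  by_cases h0 : 0 ∈ S <;> by_cases h1 : n - 1 ∈ S
  · have hcard : T.card < (Finset.Icc 1 (n - 2)).card := by
      refine Finset.card_lt_card ((Finset.ssubset_iff_of_subset fun a ha =>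
        Finset.mem_Icc.2 (hT a ha)).2 ⟨j₀, ?_, fun hj => hj₀S (Finset.mem_filter.1 hj).1⟩)
      have : j₀ ≠ 0 := fun hj => hj₀S (hj ▸ h0)
      have : j₀ ≠ n - 1 := fun hj => hj₀S (hj ▸ h1)
      exact Finset.mem_Icc.2 (by omega)
    rw [Nat.card_Icc] at hcard
    refine ⟨_, wordOf_mul_xey_mem_Wforms hasc (by rw [Finset.length_sort]; omega), ?_⟩
    have hx : φ (ltr n (n - 1)) * φ (ltr n (n - 2)) * φ (ltr n n) =
        pointIdem n (fun i => φ (ltr n i)) (n - 1) *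
          pointIdem n (fun i => φ (ltr n i)) 0 := by
      rw [pointIdem_last hn, pointIdem_zero, ← h.yxx]
      simp only [pow_two, mul_assoc]
    rw [map_mul, map_mul, map_mul, map_wordOf_sort h hn hT, mul_assoc, mul_assoc,
      ← mul_assoc (φ (ltr n (n - 1))), hx, ← mul_assoc, ← finProd_comm,
      ← finProd_insert _ hs.idem, ← finProd_comm, ← finProd_insert _ hs.idem]
    refine (key _ fun j hj => ?_).symm
    simp only [hTdef, Finset.mem_insert, Finset.mem_filter]
    grind
  · refine ⟨_, wordOf_mul_xy_mem_Wforms hn hasc, ?_⟩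
    rw [map_mul, map_mul, map_wordOf_sort h hn hT, mul_assoc, hs.x_y, ← finProd_comm,
      ← finProd_insert _ hs.idem]
    refine (key _ fun j hj => ?_).symm
    simp only [hTdef, Finset.mem_insert, Finset.mem_filter]
    grind
  · refine ⟨_, wordOf_mul_yx_mem_Wforms hn hasc, ?_⟩
    rw [map_mul, map_mul, map_wordOf_sort h hn hT, mul_assoc, hs.y_x, ← finProd_comm,
      ← finProd_insert _ hs.idem]
    refine (key _ fun j hj => ?_).symm
    simp only [hTdef, Finset.mem_insert, Finset.mem_filter]
    grind
  · refine ⟨_, wordOf_mem_Wforms hasc, ?_⟩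
    rw [map_wordOf_sort h hn hT]
    refine (key _ fun j hj => ?_).symm
    simp only [hTdef, Finset.mem_filter]
    grind

lemma exists_mem_Wforms_finProd_mul_x_pow (hφ : ∀ u v, Rrel n u v → φ u = φ v)
    (h : BasicRelations n fun i => φ (ltr n i)) (hn : 3 ≤ n) (S : Finset ℕ) {i : ℕ}
    (hi : 1 ≤ i) :
    ∃ w ∈ Wforms n, φ w = finProd (h.pointIdem_comm hn) S * φ (ltr n (n - 1)) ^ i := by
  have hs := h.shiftSystem hn
  by_cases hfull : ∀ j < n, i ≤ j → j ∈ S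
  · refine ⟨ltr n n ^ n, .inr (.inl rfl), ?_⟩
    rw [hs.finProd_x_pow_eq (S := S) (T := Finset.range n) fun j h1 h2 => by
      simp [h2, hfull j h2 h1]]
    exact ((finProd_range_mul_pow hφ h hn i).1).symm
  push Not at hfull
  obtain ⟨j₀, hj₀, hij₀, hj₀S⟩ := hfull
  set T := S.filter fun j => i ≤ j ∧ j ≤ n - 2 with hTdef
  have hTi : ∀ a ∈ T, i ≤ a ∧ a ≤ n - 2 := fun a ha => (Finset.mem_filter.1 ha).2
  have hT : ∀ a ∈ T, 1 ≤ a ∧ a ≤ n - 2 := fun a ha => by have := hTi a ha; omega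
  by_cases h1 : n - 1 ∈ S
  · have : j₀ ≠ n - 1 := fun hj => hj₀S (hj ▸ h1)
    have hcard : T.card < (Finset.Icc i (n - 2)).card :=
      Finset.card_lt_card ((Finset.ssubset_iff_of_subset fun a ha =>
        Finset.mem_Icc.2 (hTi a ha)).2 ⟨j₀, Finset.mem_Icc.2 (by omega),
          fun hj => hj₀S (Finset.mem_filter.1 hj).1⟩)
    rw [Nat.card_Icc] at hcard
    refine ⟨_, wordOf_mul_x_pow_mul_mem_Wforms hi (by rw [Finset.length_sort]; omega)
      (isAsc_sort hTi), ?_⟩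
    have hx := hs.x_pow_e i (n - (i + 1)) (by omega)
    rw [pointIdem_of_mem (j := n - (i + 1)) _ (by omega) (by omega),
      show i + (n - (i + 1)) = n - 1 by omega] at hx
    rw [map_mul, map_mul, map_pow, map_wordOf_sort h hn hT, mul_assoc, hx, ← mul_assoc,
      ← finProd_comm, ← finProd_insert _ hs.idem]
    refine hs.finProd_x_pow_eq fun j _ _ => ?_
    simp only [hTdef, Finset.mem_insert, Finset.mem_filter]
    grind
  · have hw : wordOf (ltr n) T.sort * ltr n (n - 1) ^ i ∈ Wforms n := by
      rcases eq_or_lt_of_le hi with rfl | hi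
      · rw [pow_one]
        exact wordOf_mul_ltr_mem_Wforms hn (isAsc_sort hT) le_rfl (by omega)
      · exact wordOf_mul_x_pow_mem_Wforms hi (by omega) (isAsc_sort hTi)
    refine ⟨_, hw, ?_⟩
    rw [map_mul, map_pow, map_wordOf_sort h hn hT]
    refine hs.finProd_x_pow_eq fun j _ _ => ?_
    simp only [hTdef, Finset.mem_filter]
    grind

lemma exists_mem_Wforms_finProd_mul_y_pow (hφ : ∀ u v, Rrel n u v → φ u = φ v)
    (h : BasicRelations n fun i => φ (ltr n i)) (hn : 3 ≤ n) (S : Finset ℕ) {i : ℕ}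
    (hi : 1 ≤ i) :
    ∃ w ∈ Wforms n, φ w = finProd (h.pointIdem_comm hn) S * φ (ltr n n) ^ i := by
  have hs := h.shiftSystem hn
  by_cases hfull : ∀ j, i + j < n → j ∈ S
  · refine ⟨ltr n n ^ n, .inr (.inl rfl), ?_⟩
    rw [hs.finProd_y_pow_eq (S := S) (T := Finset.range n) fun j h1 => by
      simp [hfull j h1, show j < n by omega]]
    exact ((finProd_range_mul_pow hφ h hn i).2).symm
  push Not at hfull
  obtain ⟨j₀, hij₀, hj₀S⟩ := hfull
  set T := S.filter fun j => 1 ≤ j ∧ j ≤ n - i - 1 with hTdef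
  have hTi : ∀ a ∈ T, 1 ≤ a ∧ a ≤ n - i - 1 := fun a ha => (Finset.mem_filter.1 ha).2
  have hT : ∀ a ∈ T, 1 ≤ a ∧ a ≤ n - 2 := fun a ha => by have := hTi a ha; omega
  by_cases h0 : 0 ∈ S
  · have : j₀ ≠ 0 := fun hj => hj₀S (hj ▸ h0)
    have hcard : T.card < (Finset.Icc 1 (n - i - 1)).card :=
      Finset.card_lt_card ((Finset.ssubset_iff_of_subset fun a ha =>
        Finset.mem_Icc.2 (hTi a ha)).2 ⟨j₀, Finset.mem_Icc.2 (by omega),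
          fun hj => hj₀S (Finset.mem_filter.1 hj).1⟩)
    rw [Nat.card_Icc] at hcard
    obtain ⟨d, rfl⟩ : ∃ d, i = d + 1 := ⟨i - 1, by omega⟩
    refine ⟨_, wordOf_mul_y_mul_y_pow_mem_Wforms (L := T.sort) (i := d)
      (by rw [Finset.length_sort]; omega)
      (isAsc_sort fun a ha => by have := hTi a ha; omega), ?_⟩
    have hy := hs.y_e 0 (by omega)
    rw [zero_add, pointIdem_of_mem (j := 1) _ le_rfl (by omega)] at hy
    rw [map_mul, map_mul, map_mul, map_pow, map_wordOf_sort h hn hT,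
      mul_assoc (finProd _ T), hy, ← mul_assoc, ← finProd_comm, ← finProd_insert _ hs.idem,
      mul_assoc, ← pow_succ']
    refine hs.finProd_y_pow_eq fun j _ => ?_
    simp only [hTdef, Finset.mem_insert, Finset.mem_filter]
    grind
  · have hw : wordOf (ltr n) T.sort * ltr n n ^ i ∈ Wforms n := by
      rcases eq_or_lt_of_le hi with rfl | hi
      · rw [pow_one]
        exact wordOf_mul_ltr_mem_Wforms hn (isAsc_sort hT) (by omega) le_rfl
      · exact wordOf_mul_y_pow_mem_Wforms hi (by omega) (isAsc_sort hTi)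
    refine ⟨_, hw, ?_⟩
    rw [map_mul, map_pow, map_wordOf_sort h hn hT]
    refine hs.finProd_y_pow_eq fun j _ => ?_
    simp only [hTdef, Finset.mem_filter]
    grind

lemma exists_mem_Wforms_of_isNormal (hφ : ∀ u v, Rrel n u v → φ u = φ v)
    (h : BasicRelations n fun i => φ (ltr n i)) (hn : 3 ≤ n) {m : M}
    (hm : (h.shiftSystem hn).IsNormal m) : ∃ w ∈ Wforms n, φ w = m := by
  obtain ⟨S, i, hm⟩ := hm
  rcases Nat.eq_zero_or_pos i with rfl | hi
  · rw [pow_zero, pow_zero, or_self, mul_one] at hm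
    subst hm
    exact exists_mem_Wforms_finProd hφ h hn S
  · rcases hm with rfl | rfl
    · exact exists_mem_Wforms_finProd_mul_x_pow hφ h hn S hi
    · exact exists_mem_Wforms_finProd_mul_y_pow hφ h hn S hi

lemma of_eq_ltr (j : Fin n) : FreeMonoid.of j = ltr n (j + 1) := by
  have hn : 0 < n := j.pos
  simp [ltr, hn, Nat.mod_eq_of_lt j.isLt]

lemma isNormal_map (h : BasicRelations n fun i => φ (ltr n i)) (hn : 3 ≤ n)
    (w : FreeMonoid (Fin n)) : (h.shiftSystem hn).IsNormal (φ w) := by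
  induction w using FreeMonoid.recOn with
  | one => rw [map_one]; exact (h.shiftSystem hn).isNormal_one
  | of_mul j w ih =>
    rw [map_mul, of_eq_ltr]
    have hj := j.isLt
    rcases lt_trichotomy ((j : ℕ) + 1) (n - 1) with hlt | heq | hgt
    · have := ih.e_mul (j + 1)
      rwa [pointIdem_of_mem _ (by omega) (by omega)] at this
    · rw [heq]
      exact ih.x_mul
    · rw [show (j : ℕ) + 1 = n by omega]
      exact ih.y_mul

end Reduction

/-- `W` is a set of forms for the presentation `⟨A | R⟩`: every word
over the alphabet `A = {x_1,…,x_n}` is `ρ_R`-congruent to a word of `W`. -/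
theorem Wforms_is_set_of_forms (n : ℕ) (hn : 3 ≤ n) :
    ∀ w : FreeMonoid (Fin n), ∃ w' ∈ Wforms n, conGen (Rrel n) w w' := by
  intro w
  have hφ : ∀ u v, Rrel n u v → (conGen (Rrel n)).mk' u = (conGen (Rrel n)).mk' v :=
    fun u v huv => (Con.eq _).2 (ConGen.Rel.of u v huv)
  have h := basicRelations_of_Rrel hφ
  obtain ⟨w', hw', heq⟩ := exists_mem_Wforms_of_isNormal hφ h hn (isNormal_map h hn w)
  exact ⟨w', hw', (Con.eq _).1 heq.symm⟩

end PIso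
end

section
/- In the free monoid A* modulo the congruence ρ_R generated by the relations (R1)–(R12), the following relations are consequences of R: x_1 x_{n−1}² = x_{n−1}², x_{n−1}² x_{n−2} = x_{n−1}², x_{n−2} x_n² = x_n², and x_n² x_1 = x_n²; that is, each of these pairs of words lies in ρ_R. -/
namespace PIso

/-- The four relations `x_1 x_{n-1}² = x_{n-1}²`,
`x_{n-1}² x_{n-2} = x_{n-1}²`, `x_{n-2} x_n² = x_n²` and `x_n² x_1 = x_n²` are
consequences of the relations `R`. -/
theorem extra_relations_are_consequences (n : ℕ) (hn : 3 ≤ n) :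
    conGen (Rrel n) (ltr n 1 * ltr n (n-1) ^ 2) (ltr n (n-1) ^ 2) ∧
    conGen (Rrel n) (ltr n (n-1) ^ 2 * ltr n (n-2)) (ltr n (n-1) ^ 2) ∧
    conGen (Rrel n) (ltr n (n-2) * ltr n n ^ 2) (ltr n n ^ 2) ∧
    conGen (Rrel n) (ltr n n ^ 2 * ltr n 1) (ltr n n ^ 2) := by
  have rel {u v} (h : Rrel n u v) : (u : (conGen (Rrel n)).Quotient) = v :=
    (Con.eq _).2 (ConGen.Rel.of _ _ h)
  have h5 := rel (u := ltr n (n-1) ^ 2 * ltr n n) (v := ltr n 1 * ltr n (n-1))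
    (by simp [Rrel, RrelGen])
  have h6 := rel (u := ltr n n * ltr n (n-1) ^ 2) (v := ltr n (n-1) * ltr n (n-2))
    (by simp [Rrel, RrelGen])
  have h7 := rel (u := ltr n n ^ 2 * ltr n (n-1)) (v := ltr n (n-2) * ltr n n)
    (by simp [Rrel, RrelGen])
  have h8 := rel (u := ltr n (n-1) * ltr n n ^ 2) (v := ltr n n * ltr n 1)
    (by simp [Rrel, RrelGen])
  have h9 := rel (u := ltr n (n-1) * ltr n n * ltr n (n-1)) (v := ltr n (n-1))
    (by simp [Rrel, RrelGen])
  have h10 := rel (u := ltr n n * ltr n (n-1) * ltr n n) (v := ltr n n)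
    (by simp [Rrel, RrelGen])
  simp only [← Con.eq]
  simp only [sq, Con.coe_mul] at *
  generalize (ltr n (n-1) : (conGen (Rrel n)).Quotient) = p at *
  generalize (ltr n n : (conGen (Rrel n)).Quotient) = q at *
  generalize (ltr n 1 : (conGen (Rrel n)).Quotient) = e at *
  generalize (ltr n (n-2) : (conGen (Rrel n)).Quotient) = f at *
  refine ⟨?_, ?_, ?_, ?_⟩
  · rw [← mul_assoc, ← h5, mul_assoc, mul_assoc, ← mul_assoc p q p, h9]
  · rw [mul_assoc, ← h6, ← mul_assoc, ← mul_assoc, h9]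
  · rw [← mul_assoc, ← h7, mul_assoc, mul_assoc, ← mul_assoc q p q, h10]
  · rw [mul_assoc, ← h8, ← mul_assoc, ← mul_assoc, h10]

end PIso
end
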